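/- arXiv:1402.0615 — 4 statements merged into one kernel-verified Lean document; each statement's English description precedes it below -/
import Mathlib

section
/- For every integer m ≥ 3, the wheel graph W_m satisfies: tndi(W_m) = Δ + 1 = m + 1 if m ≥ 4, and tndi(W_3) = Δ + 2 = 5 (note W_3 = K_4 has maximum degree Δ = 3, while W_m for m ≥ 4 has maximum degree Δ = m). -/
open Finset SimpleGraph

/-- A neighbor-sum-distinguishing proper total `k`-coloring of `G`:
vertex colors `cv` and edge colors `ce` taken from `{1, …, k}`, proper on
vertices, edges, and incidences, and distinguishing adjacent vertices by the
total sum of colors at each vertex. -/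
def IsProperTotalColoring {V : Type*} [Fintype V] (G : SimpleGraph V) (k : ℕ)
    (cv : V → ℕ) (ce : Sym2 V → ℕ) : Prop :=
  (∀ v, cv v ∈ Finset.Icc 1 k) ∧
  (∀ u v, G.Adj u v → ce s(u, v) ∈ Finset.Icc 1 k) ∧
  (∀ u v, G.Adj u v → cv u ≠ cv v) ∧
  (∀ u v w, G.Adj u v → G.Adj u w → v ≠ w → ce s(u, v) ≠ ce s(u, w)) ∧
  (∀ u v, G.Adj u v → ce s(u, v) ≠ cv u ∧ ce s(u, v) ≠ cv v)

open Classical in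
/-- The total color-sum at a vertex: the color of `v` plus the colors of all
edges incident with `v`. -/
noncomputable def totalSum {V : Type*} [Fintype V] (G : SimpleGraph V)
    (cv : V → ℕ) (ce : Sym2 V → ℕ) (v : V) : ℕ :=
  cv v + ∑ w ∈ Finset.univ.filter (fun w => G.Adj v w), ce s(v, w)

/-- A neighbor-sum-distinguishing proper total `k`-coloring. -/
def IsNSDColoring {V : Type*} [Fintype V] (G : SimpleGraph V) (k : ℕ)
    (cv : V → ℕ) (ce : Sym2 V → ℕ) : Prop :=
  IsProperTotalColoring G k cv ce ∧
  ∀ u v, G.Adj u v → totalSum G cv ce u ≠ totalSum G cv ce v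

/-- `tndi G` is the least `k` such that `G` admits a neighbor-sum-distinguishing
proper total `k`-coloring. -/
noncomputable def tndi {V : Type*} [Fintype V] (G : SimpleGraph V) : ℕ :=
  sInf {k | ∃ cv ce, IsNSDColoring G k cv ce}

/-- The maximum degree of a finite simple graph. -/
noncomputable def maxDeg {V : Type*} [Fintype V] (G : SimpleGraph V) : ℕ :=
  @SimpleGraph.maxDegree V G _ (Classical.decRel _)

/-- The star `S_n = K_{1,n}` with center `0` and `n` leaves. -/
def starGraph (n : ℕ) : SimpleGraph (Fin (n + 1)) :=
  SimpleGraph.fromRel fun i _ => i = 0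

/-- The wheel `W_m`: hub `0` joined to every vertex of the cycle on `1, …, m`. -/
def wheelGraph (m : ℕ) : SimpleGraph (Fin (m + 1)) :=
  SimpleGraph.fromRel fun i j =>
    i = 0 ∨ (j.val = i.val + 1 ∧ 2 ≤ j.val) ∨ (i.val = m ∧ j.val = 1)

lemma wheelGraph_adj_iff {m : ℕ} (u v : Fin (m + 1)) :
    (wheelGraph m).Adj u v ↔ u.val ≠ v.val ∧
      ((u.val = 0 ∨ (v.val = u.val + 1 ∧ 2 ≤ v.val) ∨ (u.val = m ∧ v.val = 1)) ∨
        (v.val = 0 ∨ (u.val = v.val + 1 ∧ 2 ≤ u.val) ∨ (v.val = m ∧ u.val = 1))) := by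
  simp only [wheelGraph, SimpleGraph.fromRel_adj, ne_eq, Fin.ext_iff, Fin.val_zero]

instance (m : ℕ) : DecidableRel (wheelGraph m).Adj :=
  fun u v => decidable_of_iff _ (wheelGraph_adj_iff u v).symm

lemma totalSum_eq_sum_ite {V : Type*} [Fintype V] (G : SimpleGraph V) [DecidableRel G.Adj]
    (cv : V → ℕ) (ce : Sym2 V → ℕ) (v : V) :
    totalSum G cv ce v = cv v + ∑ w, if G.Adj v w then ce s(v, w) else 0 := by
  classical
  unfold totalSum
  rw [Finset.sum_filter]
  congr!

lemma wheelGraph_adj_zero {m : ℕ} (v : Fin (m + 1)) (hv : v ≠ 0) :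
    (wheelGraph m).Adj 0 v := by
  simp [wheelGraph, hv.symm]

lemma maxDeg_eq_maxDegree {V : Type*} [Fintype V] (G : SimpleGraph V) [DecidableRel G.Adj] :
    maxDeg G = G.maxDegree := by
  unfold maxDeg
  congr!

lemma maxDeg_wheelGraph (m : ℕ) : maxDeg (wheelGraph m) = m := by
  rw [maxDeg_eq_maxDegree]
  apply le_antisymm
  · apply SimpleGraph.maxDegree_le_of_forall_degree_le
    intro v
    have := SimpleGraph.degree_lt_card_verts (G := wheelGraph m) v
    rw [Fintype.card_fin] at this
    exact Nat.lt_succ_iff.mp this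
  · have hnbr : (wheelGraph m).neighborFinset 0 = Finset.univ.erase 0 := by
      ext v
      simp only [SimpleGraph.mem_neighborFinset, Finset.mem_erase, Finset.mem_univ, and_true]
      exact ⟨fun h => h.ne', wheelGraph_adj_zero v⟩
    have hdeg : (wheelGraph m).degree 0 = m := by
      rw [← SimpleGraph.card_neighborFinset_eq_degree, hnbr]
      simp
    exact hdeg.symm.le.trans (SimpleGraph.degree_le_maxDegree (wheelGraph m) 0)

/-- The colors at the hub are pairwise distinct. -/
lemma succ_le_of_isProperTotalColoring_wheelGraph {m k : ℕ} {cv : Fin (m + 1) → ℕ}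
    {ce : Sym2 (Fin (m + 1)) → ℕ} (h : IsProperTotalColoring (wheelGraph m) k cv ce) :
    m + 1 ≤ k := by
  obtain ⟨hv, he, -, hee, hev⟩ := h
  have key := Finset.card_le_card_of_injOn (s := (Finset.univ : Finset (Fin (m + 1))))
    (t := Finset.Icc 1 k) (fun v => if v = 0 then cv 0 else ce s(0, v)) ?_ ?_
  · simpa using key
  · intro v _
    by_cases hv0 : v = 0
    · simpa [hv0] using hv 0
    · simpa [hv0] using he 0 v (wheelGraph_adj_zero v hv0)
  · intro u _ v _ huv
    by_cases hu0 : u = 0 <;> by_cases hv0 : v = 0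
    · rw [hu0, hv0]
    · simp only [hu0, hv0, if_true, if_false] at huv
      exact absurd huv.symm (hev 0 v (wheelGraph_adj_zero v hv0)).1
    · simp only [hu0, hv0, if_true, if_false] at huv
      exact absurd huv (hev 0 u (wheelGraph_adj_zero u hu0)).1
    · simp only [hu0, hv0, if_false] at huv
      by_contra hne
      exact hee 0 u v (wheelGraph_adj_zero u hu0) (wheelGraph_adj_zero v hv0) hne huv

/-- In a proper total `4`-coloring of `K₄` every vertex sees all four colors. -/
lemma five_le_of_isNSDColoring_wheelGraph_three {k : ℕ} {cv : Fin 4 → ℕ}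
    {ce : Sym2 (Fin 4) → ℕ} (h : IsNSDColoring (wheelGraph 3) k cv ce) : 5 ≤ k := by
  obtain ⟨⟨hv, he, -, hee, hev⟩, hs⟩ := h
  by_contra! hk
  have adj : ∀ u v : Fin 4, u ≠ v → (wheelGraph 3).Adj u v := by decide
  have sum_eq : ∀ a b c d : Fin 4, a ≠ b → a ≠ c → a ≠ d → b ≠ c → b ≠ d → c ≠ d →
      cv a + ce s(a, b) + ce s(a, c) + ce s(a, d) = 10 := by
    intro a b c d hab hac had hbc hbd hcd
    have h0 := Finset.mem_Icc.mp (hv a)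
    have h1 := Finset.mem_Icc.mp (he a b (adj _ _ hab))
    have h2 := Finset.mem_Icc.mp (he a c (adj _ _ hac))
    have h3 := Finset.mem_Icc.mp (he a d (adj _ _ had))
    have h4 := (hev a b (adj _ _ hab)).1
    have h5 := (hev a c (adj _ _ hac)).1
    have h6 := (hev a d (adj _ _ had)).1
    have h7 := hee a b c (adj _ _ hab) (adj _ _ hac) hbc
    have h8 := hee a b d (adj _ _ hab) (adj _ _ had) hbd
    have h9 := hee a c d (adj _ _ hac) (adj _ _ had) hcd
    omega
  have t0 := sum_eq 0 1 2 3 (by decide) (by decide) (by decide) (by decide) (by decide) (by decide)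
  have t1 := sum_eq 1 0 2 3 (by decide) (by decide) (by decide) (by decide) (by decide) (by decide)
  have h01 := hs 0 1 (adj 0 1 (by decide))
  have expand : ∀ v : Fin 4, totalSum (wheelGraph 3) cv ce v = _ := fun v =>
    (totalSum_eq_sum_ite (wheelGraph 3) cv ce v).trans
      (congrArg (cv v + ·) (Fin.sum_univ_four _))
  rw [expand, expand, if_neg (by decide), if_pos (adj 0 1 (by decide)),
    if_pos (adj 0 2 (by decide)), if_pos (adj 0 3 (by decide)), if_pos (adj 1 0 (by decide)),
    if_neg (by decide), if_pos (adj 1 2 (by decide)), if_pos (adj 1 3 (by decide))] at h01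
  omega

lemma exists_isNSDColoring_wheelGraph_three :
    ∃ cv ce, IsNSDColoring (wheelGraph 3) 5 cv ce := by
  refine ⟨![1, 2, 3, 4], fun e => (![![0, 3, 4, 5], ![0, 0, 5, 1], ![0, 0, 0, 2],
    ![0, 0, 0, 0]] : Fin 4 → Fin 4 → ℕ) e.inf e.sup, ⟨?_, ?_, ?_, ?_, ?_⟩, ?_⟩
  · decide
  · decide
  · decide
  · decide
  · decide
  · simp only [totalSum_eq_sum_ite]
    decide

lemma exists_isNSDColoring_wheelGraph_four :
    ∃ cv ce, IsNSDColoring (wheelGraph 4) 5 cv ce := by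
  refine ⟨![1, 2, 3, 2, 3], fun e => (![![0, 3, 2, 4, 5], ![0, 0, 1, 0, 4], ![0, 0, 0, 5, 0],
    ![0, 0, 0, 0, 1], ![0, 0, 0, 0, 0]] : Fin 5 → Fin 5 → ℕ) e.inf e.sup, ⟨?_, ?_, ?_, ?_, ?_⟩, ?_⟩
  · decide
  · decide
  · decide
  · decide
  · decide
  · simp only [totalSum_eq_sum_ite]
    decide

/-- The representative of `x` modulo `m` in `{1, …, m}`, for `1 ≤ x ≤ 2 * m`. -/
def cyclicColor (m x : ℕ) : ℕ := if x ≤ m then x else x - m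

/-- The vertex coloring of the wheel: the hub gets `m + 1`, the rim vertex `i` gets `i + 3`
modulo `m`. -/
def wheelVertexColor (m : ℕ) (v : Fin (m + 1)) : ℕ :=
  if v.val = 0 then m + 1 else cyclicColor m (v.val + 3)

/-- The edge coloring of the wheel: the spoke at `i` gets `i`, the rim edge from `i` to its
successor gets `i + 2` modulo `m`. -/
def wheelEdgeColor (m : ℕ) (e : Sym2 (Fin (m + 1))) : ℕ :=
  if e.inf.val = 0 then e.sup.val
  else if e.sup.val = e.inf.val + 1 then cyclicColor m (e.inf.val + 2) else cyclicColor m (m + 2)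

lemma wheelEdgeColor_mk (m : ℕ) (u v : Fin (m + 1)) :
    wheelEdgeColor m s(u, v) =
      if min u.val v.val = 0 then max u.val v.val
      else if max u.val v.val = min u.val v.val + 1 then cyclicColor m (min u.val v.val + 2)
      else cyclicColor m (m + 2) := by
  simp only [wheelEdgeColor, Sym2.inf_mk, Sym2.sup_mk, Fin.coe_min, Fin.coe_max]
  congr!

lemma isProperTotalColoring_wheel {m : ℕ} (hm : 4 ≤ m) :
    IsProperTotalColoring (wheelGraph m) (m + 1) (wheelVertexColor m) (wheelEdgeColor m) := by
  refine ⟨?_, ?_, ?_, ?_, ?_⟩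
  · intro v
    have := v.isLt
    simp only [wheelVertexColor, cyclicColor, Finset.mem_Icc]
    split_ifs <;> omega
  · intro u v h
    rw [wheelGraph_adj_iff] at h
    have := u.isLt
    have := v.isLt
    simp only [wheelEdgeColor_mk, cyclicColor, Finset.mem_Icc]
    split_ifs <;> omega
  · intro u v h
    rw [wheelGraph_adj_iff] at h
    have := u.isLt
    have := v.isLt
    simp only [wheelVertexColor, cyclicColor]
    split_ifs <;> omega
  · intro u v w huv huw hvw
    rw [wheelGraph_adj_iff] at huv huw
    have := u.isLt
    have := v.isLt
    have := w.isLt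
    have hvw' := Fin.val_ne_of_ne hvw
    simp only [wheelEdgeColor_mk, cyclicColor]
    generalize u.val = a at *
    generalize v.val = b at *
    generalize w.val = c at *
    clear hvw
    split_ifs <;> omega
  · intro u v h
    rw [wheelGraph_adj_iff] at h
    have := u.isLt
    have := v.isLt
    simp only [wheelEdgeColor_mk, wheelVertexColor, cyclicColor]
    constructor <;> split_ifs <;> omega

lemma totalSum_wheel_rim {m : ℕ} (hm : 4 ≤ m) (v : Fin (m + 1)) (hv : v.val ≠ 0) :
    totalSum (wheelGraph m) (wheelVertexColor m) (wheelEdgeColor m) v =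
      v.val + cyclicColor m (v.val + 1) + cyclicColor m (v.val + 2) +
        cyclicColor m (v.val + 3) := by
  classical
  have hlt := v.isLt
  obtain ⟨p, hp⟩ : ∃ p : Fin (m + 1), p.val = if v.val = 1 then m else v.val - 1 :=
    ⟨⟨if v.val = 1 then m else v.val - 1, by split_ifs <;> omega⟩, rfl⟩
  obtain ⟨s, hs⟩ : ∃ s : Fin (m + 1), s.val = if v.val = m then 1 else v.val + 1 :=
    ⟨⟨if v.val = m then 1 else v.val + 1, by split_ifs <;> omega⟩, rfl⟩
  have hnbr : (Finset.univ.filter fun w => (wheelGraph m).Adj v w) = {0, p, s} := by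
    ext w
    have := w.isLt
    simp only [Finset.mem_filter, Finset.mem_univ, true_and, wheelGraph_adj_iff,
      Finset.mem_insert, Finset.mem_singleton, Fin.ext_iff, Fin.val_zero]
    split_ifs at hp hs <;> omega
  have h0p : (0 : Fin (m + 1)) ∉ ({p, s} : Finset (Fin (m + 1))) := by
    simp only [Finset.mem_insert, Finset.mem_singleton, Fin.ext_iff, Fin.val_zero]
    split_ifs at hp hs <;> omega
  have hps : p ∉ ({s} : Finset (Fin (m + 1))) := by
    simp only [Finset.mem_singleton, Fin.ext_iff]
    split_ifs at hp hs <;> omega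
  have h0 : wheelEdgeColor m s(v, 0) = v.val := by
    simp [wheelEdgeColor_mk]
  have h1 : wheelEdgeColor m s(v, p) = cyclicColor m (v.val + 1) := by
    simp only [wheelEdgeColor_mk, cyclicColor]
    split_ifs at hp ⊢ <;> omega
  have h2 : wheelEdgeColor m s(v, s) = cyclicColor m (v.val + 2) := by
    simp only [wheelEdgeColor_mk, cyclicColor]
    split_ifs at hs ⊢ <;> omega
  have h3 : wheelVertexColor m v = cyclicColor m (v.val + 3) := if_neg hv
  have key : totalSum (wheelGraph m) (wheelVertexColor m) (wheelEdgeColor m) v =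
      wheelVertexColor m v + ∑ w ∈ ({0, p, s} : Finset (Fin (m + 1))),
        wheelEdgeColor m s(v, w) := by
    rw [totalSum_eq_sum_ite, ← Finset.sum_filter, hnbr]
  rw [key, Finset.sum_insert h0p, Finset.sum_insert hps, Finset.sum_singleton, h0, h1, h2, h3]
  ring

lemma totalSum_wheel_hub (m : ℕ) :
    2 * totalSum (wheelGraph m) (wheelVertexColor m) (wheelEdgeColor m) 0 =
      (m + 1) * (m + 2) := by
  have h : ∀ i : Fin m, (if (wheelGraph m).Adj 0 i.succ then wheelEdgeColor m s(0, i.succ)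
      else 0) = i.val + 1 := by
    intro i
    rw [if_pos (wheelGraph_adj_zero _ (Fin.succ_ne_zero i))]
    simp [wheelEdgeColor_mk]
  rw [totalSum_eq_sum_ite, Fin.sum_univ_succ, if_neg (SimpleGraph.irrefl _),
    Finset.sum_congr rfl fun i _ => h i, Fin.sum_univ_eq_sum_range (fun i => i + 1) m]
  have hsum : 2 * ∑ i ∈ Finset.range m, (i + 1) = m * (m + 1) := by
    clear h
    induction m with
    | zero => rfl
    | succ n ih =>
      rw [Finset.sum_range_succ, mul_add, ih]
      ring
  simp only [wheelVertexColor, Fin.val_zero, if_true]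
  linarith

lemma isNSDColoring_wheel {m : ℕ} (hm : 5 ≤ m) :
    IsNSDColoring (wheelGraph m) (m + 1) (wheelVertexColor m) (wheelEdgeColor m) := by
  refine ⟨isProperTotalColoring_wheel (by omega), ?_⟩
  have hub := totalSum_wheel_hub m
  have hub_ne : ∀ v : Fin (m + 1), v.val ≠ 0 →
      totalSum (wheelGraph m) (wheelVertexColor m) (wheelEdgeColor m) 0 ≠
        totalSum (wheelGraph m) (wheelVertexColor m) (wheelEdgeColor m) v := by
    intro v hv heq
    have hrim := totalSum_wheel_rim (by omega : 4 ≤ m) v hv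
    have hlt := v.isLt
    have hle : totalSum (wheelGraph m) (wheelVertexColor m) (wheelEdgeColor m) v ≤ 4 * m - 6 := by
      rw [hrim]
      simp only [cyclicColor]
      split_ifs <;> omega
    obtain ⟨n, rfl⟩ := Nat.exists_eq_add_of_le hm
    rw [heq] at hub
    have : 4 * (5 + n) - 6 = 14 + 4 * n := by omega
    nlinarith
  intro u v h
  by_cases hu : u.val = 0
  · obtain rfl : u = 0 := Fin.ext hu
    exact hub_ne v (Fin.val_ne_of_ne h.ne')
  by_cases hv : v.val = 0
  · obtain rfl : v = 0 := Fin.ext hv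
    exact (hub_ne u hu).symm
  rw [totalSum_wheel_rim (by omega) u hu, totalSum_wheel_rim (by omega) v hv]
  rw [wheelGraph_adj_iff] at h
  have := u.isLt
  have := v.isLt
  simp only [cyclicColor]
  split_ifs <;> omega

lemma tndi_eq_of_forall_le {V : Type*} [Fintype V] {G : SimpleGraph V} {n : ℕ}
    (hex : ∃ cv ce, IsNSDColoring G n cv ce)
    (hle : ∀ k cv ce, IsNSDColoring G k cv ce → n ≤ k) : tndi G = n :=
  IsLeast.csInf_eq ⟨hex, fun k ⟨cv, ce, h⟩ => hle k cv ce h⟩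

theorem stmt_1 (m : ℕ) (hm : 3 ≤ m) :
    (4 ≤ m → maxDeg (wheelGraph m) = m ∧ tndi (wheelGraph m) = m + 1) ∧
    (m = 3 → maxDeg (wheelGraph m) = 3 ∧ tndi (wheelGraph m) = 5) := by
  refine ⟨fun hm4 => ⟨maxDeg_wheelGraph m, tndi_eq_of_forall_le ?_ fun k cv ce h =>
    succ_le_of_isProperTotalColoring_wheelGraph h.1⟩, ?_⟩
  · rcases hm4.eq_or_lt with rfl | hm5
    · exact exists_isNSDColoring_wheelGraph_four
    · exact ⟨_, _, isNSDColoring_wheel hm5⟩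
  · rintro rfl
    exact ⟨maxDeg_wheelGraph 3, tndi_eq_of_forall_le exists_isNSDColoring_wheelGraph_three
      fun k cv ce h => five_le_of_isNSDColoring_wheelGraph_three h⟩
end

section
/- For all integers m, n ≥ 2, the Cartesian product P_m □ P_n of two paths satisfies tndi(P_m □ P_n) = Δ + 1 if m = n = 3, and tndi(P_m □ P_n) = Δ + 2 otherwise, where Δ is the maximum degree of P_m □ P_n. -/
open Finset SimpleGraph

theorem sum_adj_pathGraph {m : ℕ} [DecidableRel (pathGraph m).Adj] (i : Fin m) (f : ℕ → ℕ) :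
    (∑ x : Fin m, if (pathGraph m).Adj i x then f x else 0) =
      (if 0 < i.val then f (i - 1) else 0) + (if i.val + 1 < m then f (i + 1) else 0) := by
  have hsplit : ∀ x : Fin m, (if (pathGraph m).Adj i x then f x else 0) =
      (if x.val + 1 = i.val then f x else 0) + (if i.val + 1 = x.val then f x else 0) := by
    intro x
    simp only [pathGraph_adj]
    split_ifs <;> first | rfl | omega
  rw [Finset.sum_congr rfl fun x _ => hsplit x, Finset.sum_add_distrib]
  congr 1
  · split_ifs with h
    · rw [Finset.sum_eq_single ⟨i.val - 1, by omega⟩]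
      · rw [if_pos (by dsimp only; omega)]
      · intro x _ hx
        refine if_neg fun h' => hx (Fin.ext ?_)
        dsimp only
        omega
      · simp
    · exact Finset.sum_eq_zero fun x _ => if_neg (by omega)
  · split_ifs with h
    · rw [Finset.sum_eq_single ⟨i.val + 1, h⟩]
      · rw [if_pos rfl]
      · exact fun x _ hx => if_neg fun h' => hx (Fin.ext h'.symm)
      · simp
    · exact Finset.sum_eq_zero fun x _ => if_neg (by omega)

theorem sum_adj_boxProd {α β : Type*} [Fintype α] [Fintype β] [DecidableEq α] [DecidableEq β]
    (G : SimpleGraph α) (H : SimpleGraph β) [DecidableRel G.Adj] [DecidableRel H.Adj]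
    [DecidableRel (G.boxProd H).Adj] (v : α × β) (F : α × β → ℕ) :
    ∑ w with (G.boxProd H).Adj v w, F w =
      (∑ x, if G.Adj v.1 x then F (x, v.2) else 0) +
        ∑ y, if H.Adj v.2 y then F (v.1, y) else 0 := by
  have hsplit : ∀ x y, (if (G.boxProd H).Adj v (x, y) then F (x, y) else 0) =
      (if v.2 = y then if G.Adj v.1 x then F (x, y) else 0 else 0) +
        (if v.1 = x then if H.Adj v.2 y then F (x, y) else 0 else 0) := by
    intro x y
    simp only [boxProd_adj]
    have h1 := G.ne_of_adj (a := v.1) (b := x)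
    have h2 := H.ne_of_adj (a := v.2) (b := y)
    split_ifs <;> simp_all
  rw [Finset.sum_filter, Fintype.sum_prod_type]
  simp only [hsplit, Finset.sum_add_distrib, Finset.sum_ite_eq, Finset.mem_univ, if_true]
  congr 1
  rw [Finset.sum_comm]
  simp

theorem sum_adj_grid {m n : ℕ} [DecidableRel ((pathGraph m).boxProd (pathGraph n)).Adj]
    (v : Fin m × Fin n) (F : ℕ → ℕ → ℕ) :
    ∑ w with ((pathGraph m).boxProd (pathGraph n)).Adj v w, F w.1 w.2 =
      ((if 0 < v.1.val then F (v.1 - 1) v.2 else 0) +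
        (if v.1.val + 1 < m then F (v.1 + 1) v.2 else 0)) +
      ((if 0 < v.2.val then F v.1 (v.2 - 1) else 0) +
        (if v.2.val + 1 < n then F v.1 (v.2 + 1) else 0)) := by
  classical
  rw [sum_adj_boxProd (pathGraph m) (pathGraph n) v fun w => F w.1 w.2]
  dsimp only
  rw [sum_adj_pathGraph v.1 fun x => F x v.2, sum_adj_pathGraph v.2 fun y => F v.1 y]

open Classical in
theorem card_adj_le_maxDeg {V : Type*} [Fintype V] (G : SimpleGraph V) (v : V) :
    #{w | G.Adj v w} ≤ maxDeg G := by
  let := Classical.decRel G.Adj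
  have h := G.degree_le_maxDegree v
  rw [← G.card_neighborFinset_eq_degree, neighborFinset_eq_filter] at h
  unfold maxDeg
  convert h

open Classical in
theorem maxDeg_le {V : Type*} [Fintype V] (G : SimpleGraph V) (d : ℕ)
    (h : ∀ v, #{w | G.Adj v w} ≤ d) : maxDeg G ≤ d := by
  let := Classical.decRel G.Adj
  refine G.maxDegree_le_of_forall_degree_le d fun v => ?_
  rw [← G.card_neighborFinset_eq_degree, neighborFinset_eq_filter]
  convert h v

open Classical in
theorem card_adj_grid {m n : ℕ} (v : Fin m × Fin n) :
    #{w | ((pathGraph m).boxProd (pathGraph n)).Adj v w} =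
      ((if 0 < v.1.val then 1 else 0) + (if v.1.val + 1 < m then 1 else 0)) +
      ((if 0 < v.2.val then 1 else 0) + (if v.2.val + 1 < n then 1 else 0)) := by
  rw [Finset.card_eq_sum_ones]
  exact sum_adj_grid v fun _ _ => 1

theorem maxDeg_grid {m n : ℕ} (hm : 2 ≤ m) (hn : 2 ≤ n) :
    maxDeg ((pathGraph m).boxProd (pathGraph n)) = min (m - 1) 2 + min (n - 1) 2 := by
  apply le_antisymm
  · refine maxDeg_le _ _ fun v => ?_
    rw [card_adj_grid]
    have := v.1.isLt
    have := v.2.isLt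
    split_ifs <;> omega
  · refine le_trans ?_ (card_adj_le_maxDeg _ (⟨m - 2, by omega⟩, ⟨n - 2, by omega⟩))
    rw [card_adj_grid]
    dsimp only
    split_ifs <;> omega

open Classical in
/-- The colors seen at a vertex. -/
theorem IsProperTotalColoring.exists_colors {V : Type*} [Fintype V] {G : SimpleGraph V} {k : ℕ}
    {cv : V → ℕ} {ce : Sym2 V → ℕ} (h : IsProperTotalColoring G k cv ce) (v : V) :
    ∃ S ⊆ Finset.Icc 1 k, #S = #{w | G.Adj v w} + 1 ∧ ∑ c ∈ S, c = totalSum G cv ce v := by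
  obtain ⟨h1, h2, -, h4, h5⟩ := h
  have hinj : Set.InjOn (fun w => ce s(v, w)) ({w | G.Adj v w} : Finset V) := by
    intro a ha b hb hab
    by_contra hne
    simp only [Finset.coe_filter, Finset.mem_univ, true_and, Set.mem_ofPred_eq] at ha hb
    exact h4 v a b ha hb hne hab
  have hnot : cv v ∉ ({w | G.Adj v w} : Finset V).image fun w => ce s(v, w) := by
    simp only [Finset.mem_image, Finset.mem_filter, Finset.mem_univ, true_and, not_exists, not_and]
    exact fun w hw => (h5 v w hw).1
  refine ⟨insert (cv v) (({w | G.Adj v w} : Finset V).image fun w => ce s(v, w)), ?_, ?_, ?_⟩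
  · intro c hc
    simp only [Finset.mem_insert, Finset.mem_image, Finset.mem_filter, Finset.mem_univ,
      true_and] at hc
    obtain rfl | ⟨w, hw, rfl⟩ := hc
    · exact h1 v
    · exact h2 v w hw
  · rw [Finset.card_insert_of_notMem hnot, Finset.card_image_of_injOn hinj]
  · rw [Finset.sum_insert hnot, Finset.sum_image hinj, totalSum]

open Classical in
theorem IsNSDColoring.card_adj_add_one_le {V : Type*} [Fintype V] {G : SimpleGraph V} {k : ℕ}
    {cv : V → ℕ} {ce : Sym2 V → ℕ} (h : IsNSDColoring G k cv ce) (v : V) :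
    #{w | G.Adj v w} + 1 ≤ k := by
  obtain ⟨S, hS, hcard, -⟩ := h.1.exists_colors v
  simpa [hcard] using Finset.card_le_card hS

open Classical in
theorem IsNSDColoring.card_adj_add_two_le {V : Type*} [Fintype V] {G : SimpleGraph V} {k d : ℕ}
    {cv : V → ℕ} {ce : Sym2 V → ℕ} (h : IsNSDColoring G k cv ce) {u v : V} (huv : G.Adj u v)
    (hu : #{w | G.Adj u w} = d) (hv : #{w | G.Adj v w} = d) : d + 2 ≤ k := by
  have hle := h.card_adj_add_one_le u
  by_contra hlt
  obtain ⟨S, hS, hScard, hSsum⟩ := h.1.exists_colors u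
  obtain ⟨T, hT, hTcard, hTsum⟩ := h.1.exists_colors v
  have hS' := Finset.eq_of_subset_of_card_le hS (by rw [Nat.card_Icc]; omega)
  have hT' := Finset.eq_of_subset_of_card_le hT (by rw [Nat.card_Icc]; omega)
  exact h.2 u v huv (by rw [← hSsum, ← hTsum, hS', hT'])

theorem exists_adj_maxDeg_grid {m n : ℕ} (hm : 2 ≤ m) (hn : 2 ≤ n) (h : ¬(m = 3 ∧ n = 3)) :
    ∃ u v : Fin m × Fin n, ((pathGraph m).boxProd (pathGraph n)).Adj u v ∧
      (∀ w ∈ ({u, v} : Set _), ((if 0 < w.1.val then 1 else 0) +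
        (if w.1.val + 1 < m then 1 else 0)) + ((if 0 < w.2.val then 1 else 0) +
        (if w.2.val + 1 < n then 1 else 0)) = min (m - 1) 2 + min (n - 1) 2) := by
  by_cases h3 : m = 3
  · refine ⟨(⟨m - 2, by omega⟩, ⟨n - 3, by omega⟩), (⟨m - 2, by omega⟩, ⟨n - 3 + 1, by omega⟩),
      by simp [boxProd_adj, pathGraph_adj], ?_⟩
    simp only [Set.mem_insert_iff, Set.mem_singleton_iff, forall_eq_or_imp, forall_eq]
    constructor <;> split_ifs <;> omega
  · refine ⟨(⟨m - 3, by omega⟩, ⟨n - 2, by omega⟩), (⟨m - 3 + 1, by omega⟩, ⟨n - 2, by omega⟩),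
      by simp [boxProd_adj, pathGraph_adj], ?_⟩
    simp only [Set.mem_insert_iff, Set.mem_singleton_iff, forall_eq_or_imp, forall_eq]
    constructor <;> split_ifs <;> omega

/-- The edge coloring of the grid in which the edge from `(i, j)` to `(i + 1, j)` has color `h i j`
and the edge from `(i, j)` to `(i, j + 1)` has color `w i j`. -/
def gridEdgeColor {m n : ℕ} (h w : ℕ → ℕ → ℕ) : Sym2 (Fin m × Fin n) → ℕ :=
  Sym2.lift ⟨fun u v => if u.1.val = v.1.val then w (min u.1 v.1) (min u.2 v.2)
    else h (min u.1 v.1) (min u.2 v.2), fun u v => by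
      simp only [eq_comm, min_comm]⟩

/-- The total color-sum at `(i, j)` of the grid coloring given by `c`, `h` and `w`. -/
def gridSum (m n : ℕ) (c h w : ℕ → ℕ → ℕ) (i j : ℕ) : ℕ :=
  c i j + (((if 0 < i then h (i - 1) j else 0) + (if i + 1 < m then h i j else 0)) +
    ((if 0 < j then w i (j - 1) else 0) + (if j + 1 < n then w i j else 0)))

theorem totalSum_grid {m n : ℕ} (c h w : ℕ → ℕ → ℕ) (v : Fin m × Fin n) :
    totalSum ((pathGraph m).boxProd (pathGraph n)) (fun v => c v.1 v.2) (gridEdgeColor h w) v =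
      gridSum m n c h w v.1 v.2 := by
  classical
  unfold totalSum gridSum
  have key := sum_adj_grid v fun x y => if v.1.val = x then w (min v.1 x) (min v.2 y)
    else h (min v.1 x) (min v.2 y)
  congr 1
  refine Eq.trans ?_ (key.trans ?_)
  · simp only [gridEdgeColor, Sym2.lift_mk]
  · congr 2 <;> grind

theorem isNSDColoring_grid {m n k : ℕ} (c h w : ℕ → ℕ → ℕ)
    (hc : ∀ i < m, ∀ j < n, 1 ≤ c i j ∧ c i j ≤ k)
    (hh : ∀ i, i + 1 < m → ∀ j < n, 1 ≤ h i j ∧ h i j ≤ k ∧ h i j ≠ c i j ∧ h i j ≠ c (i + 1) j ∧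
      c i j ≠ c (i + 1) j ∧ gridSum m n c h w i j ≠ gridSum m n c h w (i + 1) j)
    (hw : ∀ i < m, ∀ j, j + 1 < n → 1 ≤ w i j ∧ w i j ≤ k ∧ w i j ≠ c i j ∧ w i j ≠ c i (j + 1) ∧
      c i j ≠ c i (j + 1) ∧ gridSum m n c h w i j ≠ gridSum m n c h w i (j + 1))
    (hhh : ∀ i, i + 2 < m → ∀ j < n, h i j ≠ h (i + 1) j)
    (hww : ∀ i < m, ∀ j, j + 2 < n → w i j ≠ w i (j + 1))
    (hhw : ∀ i, i + 1 < m → ∀ j, j + 1 < n → h i j ≠ w i j ∧ h i j ≠ w (i + 1) j ∧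
      h i (j + 1) ≠ w i j ∧ h i (j + 1) ≠ w (i + 1) j) :
    IsNSDColoring ((pathGraph m).boxProd (pathGraph n)) k (fun v => c v.1 v.2)
      (gridEdgeColor h w) := by
  have key : ∀ P : Fin m × Fin n → Fin m × Fin n → Prop, (∀ u v, P u v → P v u) →
      (∀ i j (hi : i + 1 < m) (hj : j < n),
        P (⟨i, by omega⟩, ⟨j, hj⟩) (⟨i + 1, hi⟩, ⟨j, hj⟩)) →
      (∀ i j (hi : i < m) (hj : j + 1 < n),
        P (⟨i, hi⟩, ⟨j, by omega⟩) (⟨i, hi⟩, ⟨j + 1, hj⟩)) →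
      ∀ u v, ((pathGraph m).boxProd (pathGraph n)).Adj u v → P u v := by
    rintro P hP h1 h2 ⟨⟨i, hi⟩, ⟨j, hj⟩⟩ ⟨⟨i', hi'⟩, ⟨j', hj'⟩⟩ hadj
    simp only [boxProd_adj, pathGraph_adj, Fin.mk.injEq] at hadj
    obtain ⟨rfl | rfl, rfl⟩ | ⟨rfl | rfl, rfl⟩ := hadj
    · exact h1 _ _ _ _
    · exact hP _ _ (h1 _ _ _ _)
    · exact h2 _ _ _ _
    · exact hP _ _ (h2 _ _ _ _)
  refine ⟨⟨?_, ?_, ?_, ?_, ?_⟩, ?_⟩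
  · exact fun v => Finset.mem_Icc.2 (hc _ v.1.isLt _ v.2.isLt)
  · refine key _ (fun u v huv => Sym2.eq_swap (a := u) ▸ huv) ?_ ?_
    · intro i j hi hj
      have := hh i hi j hj
      simp [gridEdgeColor, this]
    · intro i j hi hj
      have := hw i hi j hj
      simp [gridEdgeColor, this]
  · refine key _ (fun u v huv => huv.symm) ?_ ?_
    · exact fun i j hi hj => (hh i hi j hj).2.2.2.2.1
    · exact fun i j hi hj => (hw i hi j hj).2.2.2.2.1
  · rintro ⟨⟨i, hi⟩, ⟨j, hj⟩⟩ ⟨⟨a, ha⟩, ⟨b, hb⟩⟩ ⟨⟨a', ha'⟩, ⟨b', hb'⟩⟩ h1 h2 hne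
    simp only [boxProd_adj, pathGraph_adj, Fin.mk.injEq] at h1 h2
    simp only [gridEdgeColor, Sym2.lift_mk]
    obtain ⟨rfl | rfl, rfl⟩ | ⟨rfl | rfl, rfl⟩ := h1 <;>
    obtain ⟨h2 | h2, rfl⟩ | ⟨h2 | h2, rfl⟩ := h2 <;>
    (first | subst h2 | obtain rfl := Nat.succ_injective h2) <;>
    grind
  · refine key _ (fun u v huv => Sym2.eq_swap (a := u) ▸ huv.symm) ?_ ?_
    · intro i j hi hj
      have := hh i hi j hj
      simp [gridEdgeColor, this]
    · intro i j hi hj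
      have := hw i hi j hj
      simp [gridEdgeColor, this]
  · simp only [totalSum_grid]
    refine key _ (fun u v huv => huv.symm) ?_ ?_
    · exact fun i j hi hj => (hh i hi j hj).2.2.2.2.2
    · exact fun i j hi hj => (hw i hi j hj).2.2.2.2.2

theorem isNSDColoring_grid_add_two {m n : ℕ} :
    IsNSDColoring ((pathGraph m).boxProd (pathGraph n)) (min (m - 1) 2 + min (n - 1) 2 + 2)
      (fun v => 1 + (v.1 + v.2) % 2)
      (gridEdgeColor (fun i _ => 3 + i % 2) fun _ j => 3 + min (m - 1) 2 + j % 2) := by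
  refine isNSDColoring_grid (fun i j => 1 + (i + j) % 2) _ _ ?_ ?_ ?_ ?_ ?_ ?_
  · intros
    omega
  · intro i hi j hj
    refine ⟨by omega, by omega, by omega, by omega, by omega, ?_⟩
    simp only [gridSum]
    split_ifs <;> omega
  · intro i hi j hj
    refine ⟨by omega, by omega, by omega, by omega, by omega, ?_⟩
    simp only [gridSum]
    split_ifs <;> omega
  all_goals intros; omega

theorem isNSDColoring_grid_three :
    IsNSDColoring ((pathGraph 3).boxProd (pathGraph 3)) 5
      (fun v => (![![1, 2, 1], ![2, 1, 2], ![1, 4, 3]] : Fin 3 → Fin 3 → ℕ)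
        (Fin.ofNat 3 v.1) (Fin.ofNat 3 v.2))
      (gridEdgeColor
        (fun i j => (![![4, 5, 3], ![5, 2, 1]] : Fin 2 → Fin 3 → ℕ) (Fin.ofNat 2 i) (Fin.ofNat 3 j))
        fun i j => (![![3, 4], ![3, 4], ![3, 5]] : Fin 3 → Fin 2 → ℕ)
          (Fin.ofNat 3 i) (Fin.ofNat 2 j)) := by
  refine isNSDColoring_grid (fun i j => (![![1, 2, 1], ![2, 1, 2], ![1, 4, 3]] :
    Fin 3 → Fin 3 → ℕ) (Fin.ofNat 3 i) (Fin.ofNat 3 j)) _ _ ?_ ?_ ?_ ?_ ?_ ?_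
  · decide
  · intro i hi
    obtain rfl | rfl : i = 0 ∨ i = 1 := by omega
    all_goals decide
  · intro i hi j hj
    obtain rfl | rfl : j = 0 ∨ j = 1 := by omega
    all_goals revert i; decide
  · intro i hi
    obtain rfl : i = 0 := by omega
    decide
  · intro i hi j hj
    obtain rfl : j = 0 := by omega
    revert i; decide
  · intro i hi j hj
    obtain rfl | rfl : i = 0 ∨ i = 1 := by omega
    all_goals obtain rfl | rfl : j = 0 ∨ j = 1 := by omega
    all_goals decide

theorem tndi_eq_of_isNSDColoring {V : Type*} [Fintype V] {G : SimpleGraph V} {k : ℕ} {cv : V → ℕ}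
    {ce : Sym2 V → ℕ} (h : IsNSDColoring G k cv ce)
    (hmin : ∀ l cv ce, IsNSDColoring G l cv ce → k ≤ l) : tndi G = k := by
  refine IsLeast.csInf_eq ⟨⟨cv, ce, h⟩, ?_⟩
  rintro l ⟨cv', ce', hl⟩
  exact hmin l cv' ce' hl

theorem stmt_2 (m n : ℕ) (hm : 2 ≤ m) (hn : 2 ≤ n) :
    tndi ((pathGraph m).boxProd (pathGraph n)) =
      (if m = 3 ∧ n = 3 then maxDeg ((pathGraph m).boxProd (pathGraph n)) + 1
       else maxDeg ((pathGraph m).boxProd (pathGraph n)) + 2) := by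
  classical
  rw [maxDeg_grid hm hn]
  split_ifs with h
  · obtain ⟨rfl, rfl⟩ := h
    refine tndi_eq_of_isNSDColoring isNSDColoring_grid_three fun l cv ce hl => ?_
    have := hl.card_adj_add_one_le (1, 1)
    rw [card_adj_grid] at this
    simpa using this
  · refine tndi_eq_of_isNSDColoring isNSDColoring_grid_add_two fun l cv ce hl => ?_
    obtain ⟨u, v, huv, hdeg⟩ := exists_adj_maxDeg_grid hm hn h
    exact hl.card_adj_add_two_le huv ((card_adj_grid u).trans (hdeg u (by simp)))
      ((card_adj_grid v).trans (hdeg v (by simp)))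
end

section
/- For all integers m ≥ 2 and n ≥ 2, the Cartesian product K_m □ P_n of a complete graph and a path satisfies tndi(K_m □ P_n) = Δ + 2, where Δ is the maximum degree of K_m □ P_n (so Δ = m if n = 2 and Δ = m + 1 if n ≥ 3). -/
open Finset SimpleGraph

/-- The color in `{1, …, M}` of the residue of `x` modulo `M`, for `x < 2 * M`. -/
def wrap (M x : ℕ) : ℕ := if x < M then x + 1 else x + 1 - M

/-- The odd modulus used to color the layers of `K_m □ P_n`. -/
def oddModulus (m : ℕ) : ℕ := m + 1 + m % 2

/-- The color of vertex `i` in layer `t`. -/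
def layerColor (m t i : ℕ) : ℕ :=
  if t % 2 = 0 then wrap (oddModulus m) (2 * i) else wrap (oddModulus m) (i + oddModulus m - 1)

/-- The color of the edge joining the copies of vertex `i` in layers `t` and `t + 1`. -/
def rungColor (m t i : ℕ) : ℕ :=
  if m % 2 = 1 then
    if t % 2 = 0 then wrap (oddModulus m) (i + oddModulus m - 2) else oddModulus m + 1
  else if t % 2 = 0 then oddModulus m + 1 else oddModulus m + 2

/-- The edge coloring of `K_m □ P_n`. -/
def boxEdgeColor (m n : ℕ) : Sym2 (Fin m × Fin n) → ℕ :=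
  Sym2.lift ⟨fun p q =>
    if p.2 = q.2 then wrap (oddModulus m) (p.1.val + q.1.val)
    else rungColor m (min p.2.val q.2.val) (min p.1.val q.1.val), fun p q => by
      simp only [eq_comm (a := p.2), add_comm p.1.val, min_comm p.1.val, min_comm p.2.val]⟩

theorem boxEdgeColor_mk {m n : ℕ} (p q : Fin m × Fin n) :
    boxEdgeColor m n s(p, q) = if p.2 = q.2 then wrap (oddModulus m) (p.1.val + q.1.val)
      else rungColor m (min p.2.val q.2.val) (min p.1.val q.1.val) := rfl

theorem boxEdgeColor_of_snd_eq {m n : ℕ} (i j : Fin m) (t : Fin n) :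
    boxEdgeColor m n s((i, t), (j, t)) = wrap (oddModulus m) (i.val + j.val) := by
  simp [boxEdgeColor_mk]

theorem boxEdgeColor_of_fst_eq {m n : ℕ} (i : Fin m) {s t : Fin n} (h : t ≠ s) :
    boxEdgeColor m n s((i, t), (i, s)) = rungColor m (min t.val s.val) i := by
  simp [boxEdgeColor_mk, h]

theorem sum_wrap_add (M i : ℕ) (hi : i ≤ M) :
    ∑ j ∈ range M, wrap M (i + j) = ∑ j ∈ range M, wrap M j := by
  induction i with
  | zero => simp
  | succ i ih =>
    rw [← ih (by omega)]
    have h₁ := Finset.sum_range_succ (fun j => wrap M (i + j)) M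
    have h₂ := Finset.sum_range_succ' (fun j => wrap M (i + j)) M
    have h₃ : wrap M (i + M) = wrap M (i + 0) := by
      unfold wrap; split_ifs <;> omega
    have h₄ : ∑ j ∈ range M, wrap M (i + (j + 1)) = ∑ j ∈ range M, wrap M (i + 1 + j) :=
      Finset.sum_congr rfl fun j _ => by rw [add_assoc, add_comm 1 j]
    omega

/-- The colors missing from row `i` of the addition table complete it to all residues. -/
theorem sum_wrap_row (m i : ℕ) (hi : i < m) :
    (∑ j ∈ range m, wrap (oddModulus m) (i + j)) + wrap (oddModulus m) (i + oddModulus m - 1) +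
      (if m % 2 = 1 then wrap (oddModulus m) (i + oddModulus m - 2) else 0) =
    ∑ j ∈ range (oddModulus m), wrap (oddModulus m) j := by
  rw [← sum_wrap_add (oddModulus m) i (by unfold oddModulus; omega)]
  rcases Nat.mod_two_eq_zero_or_one m with h | h
  · have hM : oddModulus m = m + 1 := by unfold oddModulus; omega
    rw [hM, Finset.sum_range_succ _ m]
    simp [h, ← add_assoc]
  · have hM : oddModulus m = m + 2 := by unfold oddModulus; omega
    rw [hM, Finset.sum_range_succ _ (m + 1), Finset.sum_range_succ _ m]
    simp only [h, if_true, show i + (m + 2) - 1 = i + (m + 1) by omega,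
      show i + (m + 2) - 2 = i + m by omega]
    omega

theorem sum_pathGraph_adj {n : ℕ} [DecidableRel (pathGraph n).Adj] (t : Fin n) (g : ℕ → ℕ) :
    (∑ s : Fin n, if (pathGraph n).Adj t s then g (min t.val s.val) else 0) =
      (if t.val = 0 then 0 else g (t.val - 1)) + (if t.val + 1 < n then g t.val else 0) := by
  have h : ∀ s : Fin n, (if (pathGraph n).Adj t s then g (min t.val s.val) else 0) =
      (fun s : ℕ => (if s = t.val - 1 then (if t.val = 0 then 0 else g (t.val - 1)) else 0) +
        (if s = t.val + 1 then g t.val else 0)) s.val := by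
    intro s
    simp only [pathGraph_adj]
    have h₁ : s.val + 1 = t.val → min t.val s.val = t.val - 1 := by omega
    have h₂ : t.val + 1 = s.val → min t.val s.val = t.val := by omega
    split_ifs <;> first | omega | simp_all
  rw [Finset.sum_congr rfl fun s _ => h s,
    Fin.sum_univ_eq_sum_range (fun s : ℕ =>
      (if s = t.val - 1 then (if t.val = 0 then 0 else g (t.val - 1)) else 0) +
        (if s = t.val + 1 then g t.val else 0)) n, Finset.sum_add_distrib,
    Finset.sum_ite_eq', Finset.sum_ite_eq']
  have := t.isLt
  simp [show t.val - 1 < n by omega]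

/-- The total of the colors on the rungs at vertex `i` of layer `t`. -/
def rungSum (m n t i : ℕ) : ℕ :=
  (if t = 0 then 0 else rungColor m (t - 1) i) + (if t + 1 < n then rungColor m t i else 0)

theorem totalSum_boxEdgeColor {m n : ℕ} (i : Fin m) (t : Fin n) :
    totalSum ((⊤ : SimpleGraph (Fin m)).boxProd (pathGraph n))
      (fun p => layerColor m p.2.val p.1.val) (boxEdgeColor m n) (i, t) +
      wrap (oddModulus m) (2 * i.val) =
    layerColor m t i + (∑ j ∈ range m, wrap (oddModulus m) (i.val + j)) +
      rungSum m n t i := by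
  classical
  have hsum : (∑ w ∈ Finset.univ.filter (fun w =>
      ((⊤ : SimpleGraph (Fin m)).boxProd (pathGraph n)).Adj (i, t) w),
        boxEdgeColor m n s((i, t), w)) =
      (∑ j ∈ Finset.univ.erase i, wrap (oddModulus m) (i.val + j.val)) + rungSum m n t i := by
    rw [rungSum, ← sum_pathGraph_adj t (fun s => rungColor m s i), Finset.sum_filter,
      Fintype.sum_prod_type]
    have h : ∀ (j : Fin m) (s : Fin n),
        (if ((⊤ : SimpleGraph (Fin m)).boxProd (pathGraph n)).Adj (i, t) (j, s) then
          boxEdgeColor m n s((i, t), (j, s)) else 0) =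
        (if t = s then (if j ≠ i then wrap (oddModulus m) (i.val + j.val) else 0) else 0) +
        (if i = j then
          (if (pathGraph n).Adj t s then rungColor m (min t.val s.val) i else 0) else 0) := by
      intro j s
      by_cases hts : t = s
      · subst hts
        by_cases hij : i = j
        · subst hij; simp
        · simp [boxProd_adj, hij, Ne.symm hij, boxEdgeColor_of_snd_eq]
      · by_cases hij : i = j
        · subst hij; simp [boxProd_adj, hts, boxEdgeColor_of_fst_eq]
        · simp [boxProd_adj, hts, hij]
    simp only [h, Finset.sum_add_distrib, Finset.sum_ite_eq, Finset.mem_univ, if_true]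
    congr 1
    · rw [← Finset.sum_filter]
      congr 1
      ext; simp
    · rw [Finset.sum_comm]
      simp
  have hrow := Finset.sum_erase_add Finset.univ
    (fun j : Fin m => wrap (oddModulus m) (i.val + j.val)) (Finset.mem_univ i)
  rw [Fin.sum_univ_eq_sum_range (fun j => wrap (oddModulus m) (i.val + j)) m, ← two_mul] at hrow
  have htot : totalSum ((⊤ : SimpleGraph (Fin m)).boxProd (pathGraph n))
      (fun p => layerColor m p.2.val p.1.val) (boxEdgeColor m n) (i, t) =
      layerColor m t i + ((∑ j ∈ Finset.univ.erase i, wrap (oddModulus m) (i.val + j.val)) +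
        rungSum m n t i) := by
    rw [← hsum, totalSum]
  omega

theorem wrap_two_mul_ne {m i j : ℕ} (hij : i ≠ j) (hi : i < m) (hj : j < m) :
    wrap (oddModulus m) (2 * i) ≠ wrap (oddModulus m) (2 * j) := by
  unfold wrap oddModulus; grind

theorem wrap_pred_ne {m i j : ℕ} (hij : i ≠ j) (hi : i < m) (hj : j < m) :
    wrap (oddModulus m) (i + oddModulus m - 1) ≠ wrap (oddModulus m) (j + oddModulus m - 1) := by
  unfold wrap oddModulus; grind

theorem wrap_add_wrap_ne {m i j : ℕ} (hij : i ≠ j) (hi : i < m) (hj : j < m) :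
    wrap (oddModulus m) (i + oddModulus m - 1) + wrap (oddModulus m) (i + oddModulus m - 2) ≠
      wrap (oddModulus m) (j + oddModulus m - 1) +
        wrap (oddModulus m) (j + oddModulus m - 2) := by
  unfold wrap oddModulus; grind

theorem wrap_two_mul_ne_wrap_pred {m i : ℕ} (hi : i < m) :
    wrap (oddModulus m) (2 * i) ≠ wrap (oddModulus m) (i + oddModulus m - 1) := by
  unfold wrap oddModulus; grind

theorem wrap_two_mul_ne_add {m i : ℕ} (hm : 2 ≤ m) (hi : i < m) :
    wrap (oddModulus m) (2 * i) ≠ wrap (oddModulus m) (i + oddModulus m - 1) +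
      wrap (oddModulus m) (i + oddModulus m - 2) := by
  unfold wrap oddModulus; grind

theorem wrap_mem {M x : ℕ} (hx : x < 2 * M) : 1 ≤ wrap M x ∧ wrap M x ≤ M := by
  unfold wrap; grind

theorem isNSDColoring_boxEdgeColor {m n : ℕ} (hm : 2 ≤ m) :
    IsNSDColoring ((⊤ : SimpleGraph (Fin m)).boxProd (pathGraph n))
      (if n ≤ 2 then m + 2 else m + 3)
      (fun p => layerColor m p.2.val p.1.val) (boxEdgeColor m n) := by
  refine ⟨⟨?_, ?_, ?_, ?_, ?_⟩, ?_⟩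
  · rintro ⟨i, t⟩
    simp only [Finset.mem_Icc, layerColor, wrap, oddModulus]
    grind
  · rintro ⟨i, t⟩ ⟨j, s⟩ h
    simp only [boxProd_adj, top_adj, pathGraph_adj] at h
    simp only [Finset.mem_Icc, boxEdgeColor_mk, rungColor, wrap, oddModulus]
    grind
  · rintro ⟨i, t⟩ ⟨j, s⟩ h
    simp only [boxProd_adj, top_adj, pathGraph_adj] at h
    simp only [layerColor, wrap, oddModulus]
    grind
  · rintro ⟨i, t⟩ ⟨j, s⟩ ⟨l, r⟩ h h' hne
    simp only [boxProd_adj, top_adj, pathGraph_adj] at h h'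
    simp only [boxEdgeColor_mk, rungColor, wrap, oddModulus]
    grind
  · rintro ⟨i, t⟩ ⟨j, s⟩ h
    simp only [boxProd_adj, top_adj, pathGraph_adj] at h
    simp only [boxEdgeColor_mk, rungColor, layerColor, wrap, oddModulus]
    grind
  · rintro ⟨i, t⟩ ⟨j, s⟩ h
    simp only [boxProd_adj, top_adj, pathGraph_adj] at h
    have h₁ := totalSum_boxEdgeColor i t
    have h₂ := totalSum_boxEdgeColor j s
    intro heq
    rw [heq] at h₁
    clear heq
    generalize totalSum _ _ _ (j, s) = T at h₁ h₂
    have ht := t.isLt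
    have hs := s.isLt
    rcases h with ⟨hij, rfl⟩ | ⟨hts, rfl⟩
    · have h₃ := sum_wrap_row m i i.isLt
      have h₄ := sum_wrap_row m j j.isLt
      rw [← h₄] at h₃
      clear h₄
      generalize (∑ l ∈ range m, wrap (oddModulus m) (i.val + l)) = A at *
      generalize (∑ l ∈ range m, wrap (oddModulus m) (j.val + l)) = B at *
      have hij' : i.val ≠ j.val := fun h => hij (Fin.ext h)
      have hi := i.isLt
      have hj := j.isLt
      generalize i.val = i' at *
      generalize j.val = j' at *
      generalize t.val = t' at *
      clear i j t hij
      have hodd := wrap_add_wrap_ne hij' hi hj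
      have ha := wrap_two_mul_ne hij' hi hj
      have hb := wrap_pred_ne hij' hi hj
      unfold rungSum layerColor rungColor at *
      generalize oddModulus m = M at *
      generalize wrap M (2 * i') = a at *
      generalize wrap M (2 * j') = a' at *
      generalize wrap M (i' + M - 1) = b at *
      generalize wrap M (j' + M - 1) = b' at *
      generalize wrap M (i' + M - 2) = c at *
      generalize wrap M (j' + M - 2) = c' at *
      rcases Nat.mod_two_eq_zero_or_one m with hm2 | hm2 <;>
        simp only [hm2, if_true, if_false, zero_ne_one] at * <;> grind
    · generalize (∑ l ∈ range m, wrap (oddModulus m) (i.val + l)) = A at *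
      have hi := i.isLt
      generalize i.val = i' at *
      generalize t.val = t' at *
      generalize s.val = s' at *
      clear i t s
      have hab := wrap_two_mul_ne_wrap_pred hi
      have habc := wrap_two_mul_ne_add hm hi
      have ha : 1 ≤ _ ∧ _ := wrap_mem (M := oddModulus m) (x := 2 * i')
        (by unfold oddModulus; omega)
      have hb : 1 ≤ _ ∧ _ := wrap_mem (M := oddModulus m) (x := i' + oddModulus m - 1)
        (by unfold oddModulus; omega)
      have hc : 1 ≤ _ ∧ _ := wrap_mem (M := oddModulus m) (x := i' + oddModulus m - 2)
        (by unfold oddModulus; omega)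
      unfold rungSum layerColor rungColor at *
      generalize oddModulus m = M at *
      generalize wrap M (2 * i') = a at *
      generalize wrap M (i' + M - 1) = b at *
      generalize wrap M (i' + M - 2) = c at *
      rcases Nat.mod_two_eq_zero_or_one m with hm2 | hm2 <;>
        simp only [hm2, if_true, if_false, zero_ne_one] at * <;> grind

theorem add_two_le_of_isNSDColoring {V : Type*} [Fintype V] {G : SimpleGraph V}
    [G.LocallyFinite] {k d : ℕ}
    {cv : V → ℕ} {ce : Sym2 V → ℕ} (h : IsNSDColoring G k cv ce) {u v : V} (huv : G.Adj u v)
    (hu : G.degree u = d) (hv : G.degree v = d) : d + 2 ≤ k := by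
  classical
  obtain ⟨⟨hcv, hce, -, hee, hev⟩, hsum⟩ := h
  by_contra! hk
  have key : ∀ w, G.degree w = d → totalSum G cv ce w = ∑ c ∈ Finset.Icc 1 k, c := by
    intro w hw
    have hinj : Set.InjOn (fun x => ce s(w, x)) (Finset.univ.filter fun x => G.Adj w x) := by
      intro x hx y hy hxy
      by_contra hne
      exact hee w x y (by simpa using hx) (by simpa using hy) hne hxy
    have hnot : cv w ∉ (Finset.univ.filter fun x => G.Adj w x).image fun x => ce s(w, x) := by
      simp only [Finset.mem_image, Finset.mem_filter, Finset.mem_univ, true_and, not_exists,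
        not_and]
      exact fun x hx => (hev w x hx).1
    have hsub : insert (cv w) ((Finset.univ.filter fun x => G.Adj w x).image
        fun x => ce s(w, x)) ⊆ Finset.Icc 1 k := by
      intro c hc
      simp only [Finset.mem_insert, Finset.mem_image, Finset.mem_filter, Finset.mem_univ,
        true_and] at hc
      rcases hc with rfl | ⟨x, hx, rfl⟩
      · exact hcv w
      · exact hce w x hx
    have hcard : (Finset.univ.filter fun x => G.Adj w x).card = d := by
      rw [← hw, ← G.card_neighborFinset_eq_degree]
      congr 1
      ext; simp
    rw [← Finset.eq_of_subset_of_card_le hsub (by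
      rw [Finset.card_insert_of_notMem hnot, Finset.card_image_of_injOn hinj, hcard]
      simp; omega), Finset.sum_insert hnot, Finset.sum_image hinj, totalSum]
  exact hsum u v huv ((key u hu).trans (key v hv).symm)

theorem degree_top_boxProd_pathGraph {m n : ℕ} (i : Fin m) (t : Fin n)
    [Fintype (((⊤ : SimpleGraph (Fin m)).boxProd (pathGraph n)).neighborSet (i, t))] :
    ((⊤ : SimpleGraph (Fin m)).boxProd (pathGraph n)).degree (i, t) =
      m - 1 + ((if t.val = 0 then 0 else 1) + (if t.val + 1 < n then 1 else 0)) := by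
  classical
  rw [degree_boxProd, ← sum_pathGraph_adj t fun _ => 1, ← Finset.card_filter,
    ← (pathGraph n).neighborFinset_eq_filter, card_neighborFinset_eq_degree]
  simp

theorem maxDeg_eq_of_degree_le {V : Type*} [Fintype V] {G : SimpleGraph V} [G.LocallyFinite]
    {d : ℕ} (hle : ∀ v, G.degree v ≤ d) (v : V) (hv : G.degree v = d) : maxDeg G = d := by
  classical
  refine le_antisymm (maxDegree_le_of_forall_degree_le _ _ fun w => ?_) ?_
  · convert hle w
  · rw [← hv]
    refine le_of_eq_of_le ?_ (degree_le_maxDegree G v)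
    congr!


theorem stmt_5 (m n : ℕ) (hm : 2 ≤ m) (hn : 2 ≤ n) :
    (n = 2 → maxDeg ((⊤ : SimpleGraph (Fin m)).boxProd (pathGraph n)) = m) ∧
    (3 ≤ n → maxDeg ((⊤ : SimpleGraph (Fin m)).boxProd (pathGraph n)) = m + 1) ∧
    tndi ((⊤ : SimpleGraph (Fin m)).boxProd (pathGraph n)) =
      maxDeg ((⊤ : SimpleGraph (Fin m)).boxProd (pathGraph n)) + 2 := by
  classical
  have h₂ : n = 2 → maxDeg ((⊤ : SimpleGraph (Fin m)).boxProd (pathGraph n)) = m := fun h =>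
    maxDeg_eq_of_degree_le (fun ⟨i, t⟩ => by
      rw [degree_top_boxProd_pathGraph]; split_ifs <;> omega) (⟨0, by omega⟩, ⟨0, by omega⟩) (by
      rw [degree_top_boxProd_pathGraph]; grind)
  have h₃ : 3 ≤ n → maxDeg ((⊤ : SimpleGraph (Fin m)).boxProd (pathGraph n)) = m + 1 := fun h =>
    maxDeg_eq_of_degree_le (fun ⟨i, t⟩ => by
      rw [degree_top_boxProd_pathGraph]; split_ifs <;> omega) (⟨0, by omega⟩, ⟨1, by omega⟩) (by
      rw [degree_top_boxProd_pathGraph]; grind)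
  have hk : maxDeg ((⊤ : SimpleGraph (Fin m)).boxProd (pathGraph n)) + 2 =
      if n ≤ 2 then m + 2 else m + 3 := by
    split_ifs <;> omega
  refine ⟨h₂, h₃, le_antisymm (Nat.sInf_le ?_) (le_csInf ?_ ?_)⟩
  · exact ⟨_, _, hk ▸ isNSDColoring_boxEdgeColor hm⟩
  · exact ⟨_, _, _, isNSDColoring_boxEdgeColor hm⟩
  · rintro k ⟨cv, ce, h⟩
    have hdeg : ∀ i : Fin m, ((⊤ : SimpleGraph (Fin m)).boxProd (pathGraph n)).degree
        (i, ⟨1, by omega⟩) = maxDeg ((⊤ : SimpleGraph (Fin m)).boxProd (pathGraph n)) := by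
      intro i
      rw [degree_top_boxProd_pathGraph]
      grind
    refine add_two_le_of_isNSDColoring h ?_ (hdeg ⟨0, by omega⟩) (hdeg ⟨1, by omega⟩)
    simp [boxProd_adj]
end

section
/- For all integers n ≥ 3 and m ≥ 3, the Cartesian product C_n □ C_m of two cycles satisfies tndi(C_n □ C_m) = Δ + 2 = 6, where Δ = 4 is the maximum degree of C_n □ C_m. -/
open Finset SimpleGraph

/-! ### The lower bound -/

/-- At a vertex of degree at least `k - 1`, a proper total `k`-coloring uses every color exactly
once, so the color sum there is `1 + ⋯ + k`. -/
lemma IsProperTotalColoring.totalSum_eq {V : Type*} [Fintype V] {G : SimpleGraph V} {k : ℕ}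
    {cv : V → ℕ} {ce : Sym2 V → ℕ} (h : IsProperTotalColoring G k cv ce) (v : V)
    [Fintype (G.neighborSet v)] (hk : k ≤ G.degree v + 1) :
    totalSum G cv ce v = ∑ i ∈ Finset.Icc 1 k, i := by
  classical
  obtain ⟨hv, he, -, hee, hve⟩ := h
  have hinj : Set.InjOn (fun w => ce s(v, w)) (G.neighborFinset v) := by
    intro a ha b hb hab
    by_contra hne
    exact hee v a b (by simpa using ha) (by simpa using hb) hne hab
  have hnot : cv v ∉ (G.neighborFinset v).image (fun w => ce s(v, w)) := by
    simp only [Finset.mem_image, mem_neighborFinset, not_exists, not_and]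
    exact fun w hw => (hve v w hw).1
  have hsub : insert (cv v) ((G.neighborFinset v).image (fun w => ce s(v, w))) ⊆
      Finset.Icc 1 k := by
    intro x hx
    rcases Finset.mem_insert.1 hx with rfl | hx
    · exact hv v
    · obtain ⟨w, hw, rfl⟩ := Finset.mem_image.1 hx
      exact he v w (by simpa using hw)
  have hcard : (insert (cv v) ((G.neighborFinset v).image (fun w => ce s(v, w)))).card =
      G.degree v + 1 := by
    rw [Finset.card_insert_of_notMem hnot, Finset.card_image_of_injOn hinj,
      card_neighborFinset_eq_degree]
  have heq := Finset.eq_of_subset_of_card_le hsub (by rw [hcard]; simpa using hk)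
  rw [← heq, Finset.sum_insert hnot, Finset.sum_image hinj, totalSum]
  congr 1
  refine Finset.sum_congr ?_ fun _ _ => rfl
  ext w
  simp

/-- A neighbor-sum-distinguishing coloring of a `d`-regular graph with at least one edge needs at
least `d + 2` colors. -/
lemma IsNSDColoring.add_two_le {V : Type*} [Fintype V] {G : SimpleGraph V} [G.LocallyFinite]
    {d k : ℕ} {cv : V → ℕ} {ce : Sym2 V → ℕ} (h : IsNSDColoring G k cv ce)
    (hd : G.IsRegularOfDegree d) {u v : V} (huv : G.Adj u v) : d + 2 ≤ k := by
  by_contra! hk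
  refine h.2 u v huv ?_
  rw [h.1.totalSum_eq u (by rw [hd u]; omega), h.1.totalSum_eq v (by rw [hd v]; omega)]

/-! ### Coloring four-regular graphs generated by two permutations -/

/-- The edge coloring that gives the edge from `x` to `R x` the color `H x` and the edge from `x`
to `T x` the color `U x`. -/
def permEdgeColor {V : Type*} [DecidableEq V] (R T : Equiv.Perm V) (H U : V → ℕ) :
    Sym2 V → ℕ :=
  let g : V → V → ℕ := fun x y => if y = R x then H x else if y = T x then U x else 0
  Sym2.lift ⟨fun x y => g x y + g y x, fun _ _ => add_comm _ _⟩

section PermGraph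

variable {V : Type*} [DecidableEq V] {R T : Equiv.Perm V}

lemma permEdgeColor_right (hd : ∀ p, [R p, R.symm p, T p, T.symm p].Nodup) (H U : V → ℕ) (p : V) :
    permEdgeColor R T H U s(p, R p) = H p := by
  have h := hd p
  have h1 : p ≠ R (R p) := fun e => by simp [(Equiv.symm_apply_eq _).2 e] at h
  have h2 : p ≠ T (R p) := fun e => by simp [(Equiv.symm_apply_eq _).2 e] at h
  simp [permEdgeColor, h1, h2]

lemma permEdgeColor_up (hd : ∀ p, [R p, R.symm p, T p, T.symm p].Nodup) (H U : V → ℕ) (p : V) :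
    permEdgeColor R T H U s(p, T p) = U p := by
  have h := hd p
  have h1 : p ≠ R (T p) := fun e => by simp [(Equiv.symm_apply_eq _).2 e] at h
  have h2 : p ≠ T (T p) := fun e => by simp [(Equiv.symm_apply_eq _).2 e] at h
  have h3 : T p ≠ R p := fun e => by simp [e] at h
  simp [permEdgeColor, h1, h2, h3]

lemma permEdgeColor_left (hd : ∀ p, [R p, R.symm p, T p, T.symm p].Nodup) (H U : V → ℕ) (p : V) :
    permEdgeColor R T H U s(p, R.symm p) = H (R.symm p) := by
  have := permEdgeColor_right hd H U (R.symm p)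
  rwa [Equiv.apply_symm_apply, Sym2.eq_swap] at this

lemma permEdgeColor_down (hd : ∀ p, [R p, R.symm p, T p, T.symm p].Nodup) (H U : V → ℕ) (p : V) :
    permEdgeColor R T H U s(p, T.symm p) = U (T.symm p) := by
  have := permEdgeColor_up hd H U (T.symm p)
  rwa [Equiv.apply_symm_apply, Sym2.eq_swap] at this

/-- Local conditions under which `C`, `H`, `U` define a neighbor-sum-distinguishing coloring of the
graph whose edges join each `x` to `R x` and to `T x`. -/
lemma isNSDColoring_permEdgeColor [Fintype V] {G : SimpleGraph V}
    (hG : ∀ p q, G.Adj p q ↔ q = R p ∨ q = R.symm p ∨ q = T p ∨ q = T.symm p)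
    (hd : ∀ p, [R p, R.symm p, T p, T.symm p].Nodup) {k : ℕ} {C H U : V → ℕ}
    (hC : ∀ p, C p ∈ Finset.Icc 1 k) (hH : ∀ p, H p ∈ Finset.Icc 1 k)
    (hU : ∀ p, U p ∈ Finset.Icc 1 k)
    (hstar : ∀ p, [C p, H p, H (R.symm p), U p, U (T.symm p)].Nodup)
    (hCR : ∀ p, C p ≠ C (R p)) (hCT : ∀ p, C p ≠ C (T p))
    (hSR : ∀ p, C p + H p + H (R.symm p) + U p + U (T.symm p) ≠
      C (R p) + H (R p) + H p + U (R p) + U (T.symm (R p)))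
    (hST : ∀ p, C p + H p + H (R.symm p) + U p + U (T.symm p) ≠
      C (T p) + H (T p) + H (R.symm (T p)) + U (T p) + U p) :
    IsNSDColoring G k C (permEdgeColor R T H U) := by
  have er := permEdgeColor_right hd H U
  have el := permEdgeColor_left hd H U
  have eu := permEdgeColor_up hd H U
  have ed := permEdgeColor_down hd H U
  have hsum : ∀ p, totalSum G C (permEdgeColor R T H U) p =
      C p + H p + H (R.symm p) + U p + U (T.symm p) := by
    intro p
    classical
    have hset : Finset.univ.filter (fun w => G.Adj p w) =
        {R p, R.symm p, T p, T.symm p} := by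
      ext w
      simp [hG]
    have h := hd p
    simp only [List.nodup_cons, List.mem_cons, List.not_mem_nil, or_false, not_or] at h
    rw [totalSum]
    convert_to C p + ∑ w ∈ {R p, R.symm p, T p, T.symm p}, permEdgeColor R T H U s(p, w) = _
    · rw [← hset]
    rw [Finset.sum_insert (by simp; tauto), Finset.sum_insert (by simp; tauto),
      Finset.sum_insert (by simp; tauto), Finset.sum_singleton, er, el, eu, ed]
    ring
  have hCR' : ∀ p, C p ≠ C (R.symm p) := fun p => by simpa using (hCR (R.symm p)).symm
  have hCT' : ∀ p, C p ≠ C (T.symm p) := fun p => by simpa using (hCT (T.symm p)).symm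
  have hvert : ∀ u v, G.Adj u v → permEdgeColor R T H U s(u, v) ≠ C u := by
    intro u v huv
    have h := hstar u
    simp only [List.nodup_cons, List.mem_cons, List.not_mem_nil, or_false, not_or] at h
    rcases (hG u v).1 huv with rfl | rfl | rfl | rfl <;> simp only [er, el, eu, ed] <;> tauto
  refine ⟨⟨hC, ?_, ?_, ?_, ?_⟩, ?_⟩
  · intro u v huv
    rcases (hG u v).1 huv with rfl | rfl | rfl | rfl <;> simp only [er, el, eu, ed, hH, hU]
  · intro u v huv
    rcases (hG u v).1 huv with rfl | rfl | rfl | rfl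
    exacts [hCR u, hCR' u, hCT u, hCT' u]
  · intro u v w huv huw hvw
    have h := hstar u
    simp only [List.nodup_cons, List.mem_cons, List.not_mem_nil, or_false, not_or] at h
    rcases (hG u v).1 huv with rfl | rfl | rfl | rfl <;>
      rcases (hG u w).1 huw with rfl | rfl | rfl | rfl <;>
      simp only [er, el, eu, ed] <;> tauto
  · exact fun u v huv => ⟨hvert u v huv, Sym2.eq_swap ▸ hvert v u huv.symm⟩
  · intro u v huv
    rw [hsum, hsum]
    rcases (hG u v).1 huv with rfl | rfl | rfl | rfl
    · simpa using hSR u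
    · simpa using (hSR (R.symm u)).symm
    · simpa using hST u
    · simpa using (hST (T.symm u)).symm

end PermGraph

/-! ### Labels of cycle positions

Each cycle is cut into blocks labelled `0, 1, 2`, preceded by at most one block labelled
`3, 4, 5, 6` or `7, 8, 4, 5, 6`. -/

/-- `LabelStep s t` holds if label `t` may follow label `s` along a cycle. -/
def LabelStep (s t : Fin 9) : Prop :=
  t ∈ (![[1], [2], [0, 3, 7], [4], [5], [6], [0, 3, 7], [8], [4]] : Fin 9 → List (Fin 9)) s

instance (s t : Fin 9) : Decidable (LabelStep s t) := by
  unfold LabelStep; infer_instance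

/-- The periodic sequence `0, 1, 2, 0, 1, 2, …`. -/
def labelThree : ℕ → Fin 9
  | 0 => 0
  | 1 => 1
  | 2 => 2
  | i + 3 => labelThree i

/-- The sequence `3, 4, 5, 6` followed by `0, 1, 2, 0, 1, 2, …`. -/
def labelFour : ℕ → Fin 9
  | 0 => 3
  | 1 => 4
  | 2 => 5
  | 3 => 6
  | i + 4 => labelThree i

/-- The sequence `7, 8, 4, 5, 6` followed by `0, 1, 2, 0, 1, 2, …`. -/
def labelFive : ℕ → Fin 9
  | 0 => 7
  | 1 => 8
  | 2 => 4
  | 3 => 5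
  | 4 => 6
  | i + 5 => labelThree i

lemma labelStep_labelThree : ∀ i, LabelStep (labelThree i) (labelThree (i + 1))
  | 0 => by decide
  | 1 => by decide
  | 2 => by decide
  | i + 3 => labelStep_labelThree i

lemma labelThree_mul_add_two : ∀ k, labelThree (3 * k + 2) = 2
  | 0 => rfl
  | k + 1 => labelThree_mul_add_two k

lemma labelStep_labelFour : ∀ i, LabelStep (labelFour i) (labelFour (i + 1))
  | 0 => by decide
  | 1 => by decide
  | 2 => by decide
  | 3 => by decide
  | i + 4 => labelStep_labelThree i

lemma labelStep_labelFive : ∀ i, LabelStep (labelFive i) (labelFive (i + 1))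
  | 0 => by decide
  | 1 => by decide
  | 2 => by decide
  | 3 => by decide
  | 4 => by decide
  | i + 5 => labelStep_labelThree i

/-- For every length at least three there is a cyclic sequence of labels. -/
lemma exists_cyclic_label (n : ℕ) (hn : 3 ≤ n) :
    ∃ f : ℕ → Fin 9, (∀ i, LabelStep (f i) (f (i + 1))) ∧ LabelStep (f (n - 1)) (f 0) := by
  obtain ⟨k, rfl | rfl | rfl⟩ : ∃ k, n = 3 * k + 3 ∨ n = 3 * k + 4 ∨ n = 3 * k + 5 :=
    ⟨n / 3 - 1, by omega⟩
  · refine ⟨labelThree, labelStep_labelThree, ?_⟩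
    rw [show 3 * k + 3 - 1 = 3 * k + 2 by omega, labelThree_mul_add_two]
    decide
  · refine ⟨labelFour, labelStep_labelFour, ?_⟩
    rcases k with _ | k
    · decide
    · rw [show 3 * (k + 1) + 4 - 1 = (3 * k + 2) + 4 by omega]
      change LabelStep (labelThree (3 * k + 2)) _
      rw [labelThree_mul_add_two]
      decide
  · refine ⟨labelFive, labelStep_labelFive, ?_⟩
    rcases k with _ | k
    · decide
    · rw [show 3 * (k + 1) + 5 - 1 = (3 * k + 2) + 5 by omega]
      change LabelStep (labelThree (3 * k + 2)) _
      rw [labelThree_mul_add_two]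
      decide

lemma exists_fin_label (n : ℕ) [NeZero n] (hn : 3 ≤ n) :
    ∃ f : Fin n → Fin 9, ∀ i, LabelStep (f i) (f (i + 1)) := by
  obtain ⟨f, hf, hf0⟩ := exists_cyclic_label n hn
  refine ⟨fun i => f i, fun i => ?_⟩
  rcases Nat.lt_or_ge (i + 1 : ℕ) n with h | h
  · have : ((i + 1 : Fin n) : ℕ) = i + 1 := by
      rw [Fin.val_add, Fin.val_one', Nat.mod_eq_of_lt (show 1 < n by omega), Nat.mod_eq_of_lt h]
    simpa only [this] using hf i
  · have hi : (i : ℕ) = n - 1 := by omega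
    have : ((i + 1 : Fin n) : ℕ) = 0 := by
      rw [Fin.val_add, Fin.val_one', Nat.mod_eq_of_lt (show 1 < n by omega), hi,
        Nat.sub_add_cancel (by omega), Nat.mod_self]
    simpa only [this, hi] using hf0

/-! ### The color tables -/

/-- The color of a vertex with given labels. -/
def vertexTable : Fin 9 → Fin 9 → ℕ :=
  ![![5, 1, 2, 4, 1, 3, 2, 5, 2],
    ![6, 5, 3, 6, 4, 1, 4, 6, 5],
    ![1, 3, 4, 1, 6, 2, 3, 1, 3],
    ![4, 6, 2, 4, 2, 3, 2, 5, 6],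
    ![2, 4, 6, 2, 1, 2, 4, 1, 3],
    ![1, 6, 5, 1, 4, 3, 5, 3, 6],
    ![6, 2, 4, 5, 3, 1, 3, 2, 1],
    ![3, 5, 1, 4, 2, 6, 5, 3, 6],
    ![1, 3, 2, 5, 6, 5, 2, 4, 5]]

/-- The color of the edge from a vertex with given labels to its successor in the first
coordinate. -/
def rightTable : Fin 9 → Fin 9 → ℕ :=
  ![![4, 6, 1, 3, 2, 2, 5, 3, 3],
    ![3, 2, 5, 4, 3, 6, 1, 5, 6],
    ![2, 4, 3, 2, 4, 4, 4, 4, 4],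
    ![3, 2, 4, 1, 5, 1, 3, 3, 2],
    ![6, 5, 1, 6, 6, 4, 1, 2, 5],
    ![5, 1, 6, 3, 1, 6, 6, 6, 3],
    ![2, 4, 3, 2, 4, 4, 4, 4, 4],
    ![4, 6, 5, 3, 3, 3, 1, 5, 3],
    ![3, 2, 4, 1, 5, 1, 3, 3, 2]]

/-- The color of the edge from a vertex with given labels to its successor in the second
coordinate. -/
def upTable : Fin 9 → Fin 9 → ℕ :=
  ![![3, 5, 6, 5, 6, 1, 6, 1, 5],
    ![1, 4, 2, 1, 5, 3, 2, 4, 1],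
    ![5, 1, 6, 5, 1, 5, 6, 2, 5],
    ![1, 5, 6, 3, 6, 5, 6, 1, 3],
    ![1, 3, 5, 4, 3, 6, 5, 6, 4],
    ![3, 2, 4, 2, 5, 2, 4, 1, 2],
    ![3, 5, 1, 6, 2, 5, 1, 5, 6],
    ![1, 2, 6, 1, 5, 2, 6, 2, 1],
    ![5, 1, 6, 4, 2, 4, 6, 1, 4]]

/-- The color sum at a vertex with labels `s` and `t` whose predecessors in the two coordinates
have labels `a` and `b`. -/
def tableSum (a s b t : Fin 9) : ℕ :=
  vertexTable s t + rightTable s t + rightTable a t + upTable s t + upTable s b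

lemma table_mem : ∀ s t, vertexTable s t ∈ Finset.Icc 1 6 ∧ rightTable s t ∈ Finset.Icc 1 6 ∧
    upTable s t ∈ Finset.Icc 1 6 := by
  simp only [Finset.mem_Icc]
  decide +kernel

lemma table_nodup : ∀ a s, LabelStep a s → ∀ b t, LabelStep b t →
    [vertexTable s t, rightTable s t, rightTable a t, upTable s t, upTable s b].Nodup := by
  decide +kernel

lemma vertexTable_ne : ∀ s s', LabelStep s s' → ∀ t,
    vertexTable s t ≠ vertexTable s' t ∧ vertexTable t s ≠ vertexTable t s' := by
  decide +kernel

lemma tableSum_ne_right : ∀ a s, LabelStep a s → ∀ s', LabelStep s s' → ∀ b t, LabelStep b t →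
    tableSum a s b t ≠ tableSum s s' b t := by
  decide +kernel

lemma tableSum_ne_up : ∀ a s, LabelStep a s → ∀ b t, LabelStep b t → ∀ t', LabelStep t t' →
    tableSum a s b t ≠ tableSum a s t t' := by
  decide +kernel

/-! ### The torus -/

lemma cycleGraph_adj_iff_add_one (n : ℕ) [NeZero n] (hn : 3 ≤ n) (u v : Fin n) :
    (cycleGraph n).Adj u v ↔ v = u + 1 ∨ v = u - 1 := by
  obtain ⟨n, rfl⟩ : ∃ k, n = k + 2 := ⟨n - 2, by omega⟩
  rw [cycleGraph_adj, or_comm, sub_eq_iff_eq_add', eq_sub_iff_add_eq, sub_eq_iff_eq_add']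
  simp only [eq_comm]

lemma fin_add_one_ne_sub_one (n : ℕ) [NeZero n] (hn : 3 ≤ n) (i : Fin n) : i + 1 ≠ i - 1 := by
  obtain ⟨n, rfl⟩ : ∃ k, n = k + 3 := ⟨n - 3, by omega⟩
  intro h
  rw [eq_sub_iff_add_eq, add_assoc, add_eq_left] at h
  have h2 : 2 % (n + 3) = 0 := by simpa [Fin.ext_iff, Fin.val_add] using h
  rw [Nat.mod_eq_of_lt (by omega)] at h2
  omega

/-- Every torus grid has a neighbor-sum-distinguishing proper total `6`-coloring. -/
lemma exists_isNSDColoring_torus (n m : ℕ) (hn : 3 ≤ n) (hm : 3 ≤ m) :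
    ∃ cv ce, IsNSDColoring ((cycleGraph n).boxProd (cycleGraph m)) 6 cv ce := by
  have : NeZero n := ⟨by omega⟩
  have : NeZero m := ⟨by omega⟩
  have : Nontrivial (Fin n) := Fin.nontrivial_iff_two_le.2 (by omega)
  have : Nontrivial (Fin m) := Fin.nontrivial_iff_two_le.2 (by omega)
  obtain ⟨f, hf⟩ := exists_fin_label n hn
  obtain ⟨g, hg⟩ := exists_fin_label m hm
  have hf' : ∀ i, LabelStep (f (i - 1)) (f i) := fun i => by simpa using hf (i - 1)
  have hg' : ∀ i, LabelStep (g (i - 1)) (g i) := fun i => by simpa using hg (i - 1)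
  let R : Equiv.Perm (Fin n × Fin m) := (Equiv.addRight 1).prodCongr (Equiv.refl _)
  let T : Equiv.Perm (Fin n × Fin m) := (Equiv.refl _).prodCongr (Equiv.addRight 1)
  have hR : ∀ p, R p = (p.1 + 1, p.2) := fun _ => rfl
  have hT : ∀ p, T p = (p.1, p.2 + 1) := fun _ => rfl
  have hR' : ∀ p, R.symm p = (p.1 - 1, p.2) := fun p => by simp [Equiv.symm_apply_eq, hR]
  have hT' : ∀ p, T.symm p = (p.1, p.2 - 1) := fun p => by simp [Equiv.symm_apply_eq, hT]
  refine ⟨fun p => vertexTable (f p.1) (g p.2), permEdgeColor R T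
    (fun p => rightTable (f p.1) (g p.2)) (fun p => upTable (f p.1) (g p.2)),
    isNSDColoring_permEdgeColor ?_ ?_ ?_ ?_ ?_ ?_ ?_ ?_ ?_ ?_⟩
  · rintro ⟨i, j⟩ ⟨i', j'⟩
    simp only [boxProd_adj, cycleGraph_adj_iff_add_one n hn, cycleGraph_adj_iff_add_one m hm,
      hR, hR', hT, hT', Prod.mk.injEq]
    tauto
  · rintro ⟨i, j⟩
    simp [hR, hR', hT, hT', fin_add_one_ne_sub_one n hn, fin_add_one_ne_sub_one m hm,
      show n ≠ 1 by omega, show m ≠ 1 by omega]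
  · exact fun p => (table_mem _ _).1
  · exact fun p => (table_mem _ _).2.1
  · exact fun p => (table_mem _ _).2.2
  · intro p
    simp only [hR', hT']
    exact table_nodup _ _ (hf' _) _ _ (hg' _)
  · exact fun p => (vertexTable_ne _ _ (hf _) _).1
  · exact fun p => (vertexTable_ne _ _ (hg _) _).2
  · intro p
    simp only [hR, hR', hT']
    exact tableSum_ne_right _ _ (hf' _) _ (hf _) _ _ (hg' _)
  · intro p
    simp only [hT, hR', hT']
    exact tableSum_ne_up _ _ (hf' _) _ _ (hg' _) _ (hg _)

lemma isRegularOfDegree_torus (n m : ℕ) (hn : 3 ≤ n) (hm : 3 ≤ m)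
    [((cycleGraph n).boxProd (cycleGraph m)).LocallyFinite] :
    ((cycleGraph n).boxProd (cycleGraph m)).IsRegularOfDegree 4 := by
  obtain ⟨n, rfl⟩ : ∃ k, n = k + 3 := ⟨n - 3, by omega⟩
  obtain ⟨m, rfl⟩ : ∃ k, m = k + 3 := ⟨m - 3, by omega⟩
  intro p
  rw [degree_boxProd, cycleGraph_degree_three_le, cycleGraph_degree_three_le]

theorem stmt_9 (n m : ℕ) (hn : 3 ≤ n) (hm : 3 ≤ m) :
    maxDeg ((cycleGraph n).boxProd (cycleGraph m)) = 4 ∧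
    tndi ((cycleGraph n).boxProd (cycleGraph m)) = 6 := by
  have : NeZero n := ⟨by omega⟩
  have : NeZero m := ⟨by omega⟩
  refine ⟨?_, le_antisymm (Nat.sInf_le (exists_isNSDColoring_torus n m hn hm))
    (le_csInf ⟨6, exists_isNSDColoring_torus n m hn hm⟩ ?_)⟩
  · classical
    exact IsRegularOfDegree.maxDegree_eq _ (by convert isRegularOfDegree_torus n m hn hm)
  · rintro k ⟨cv, ce, h⟩
    classical
    refine h.add_two_le (isRegularOfDegree_torus n m hn hm) (u := (0, 0)) (v := (1, 0)) ?_
    rw [boxProd_adj_left, cycleGraph_adj_iff_add_one n hn]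
    simp
end
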